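/- For every positive integer k and every proper deterministic online coloring algorithm A with known representation, there exists a finite sequence of closed intervals in ℝ whose lengths take at most two distinct values, whose clique number is at most 4k, and on which A uses at least 8k colors. -/

import Mathlib

/-- A deterministic online coloring algorithm with known representation:
it assigns to each finite sequence of closed intervals a color for the last
interval. -/
def KnownRepAlg : Type := ∀ i : ℕ, (Fin (i + 1) → ℝ × ℝ) → ℕ

/-- The coloring produced when a sequence of intervals is presented to the
algorithm `A` one by one. -/
def knownColoring (A : KnownRepAlg) {n : ℕ} (x : Fin n → ℝ × ℝ) (i : Fin n) : ℕ :=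
  A i.1 (x ∘ Fin.castLE i.isLt)

/-- The algorithm `A` is proper: on every presented sequence of closed
intervals, intersecting intervals receive distinct colors. -/
def IsProperKnown (A : KnownRepAlg) : Prop :=
  ∀ (n : ℕ) (x : Fin n → ℝ × ℝ), (∀ i, (x i).1 ≤ (x i).2) →
    ∀ i j : Fin n, i ≠ j →
      (Set.Icc (x i).1 (x i).2 ∩ Set.Icc (x j).1 (x j).2).Nonempty →
      knownColoring A x i ≠ knownColoring A x j

/-- A history of the coloring game: a list of entries `(a, b, c)`, most recent first, each
recording that the interval `[a, b]` received the color `c`. -/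
abbrev History : Type := List (ℝ × ℝ × ℕ)

namespace History

/-- The number of recorded intervals that contain `t`. -/
noncomputable def depth (S : History) (t : ℝ) : ℕ :=
  S.countP (fun e => decide (e.1 ≤ t ∧ t ≤ e.2.1))

/-- The set of colors used in a history. -/
def colors (S : History) : Finset ℕ := (S.map (fun e => e.2.2)).toFinset

lemma depth_append (S T : History) (t : ℝ) : depth (S ++ T) t = depth S t + depth T t := by
  simp [depth]

lemma colors_append (S T : History) : colors (S ++ T) = colors S ∪ colors T := by
  simp [colors]

lemma mem_colors {S : History} {c : ℕ} : c ∈ colors S ↔ ∃ e ∈ S, e.2.2 = c := by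
  simp [colors]

lemma depth_le_length (S : History) (t : ℝ) : depth S t ≤ S.length := List.countP_le_length

lemma depth_eq_zero {S : History} {t : ℝ} (h : ∀ e ∈ S, t < e.1 ∨ e.2.1 < t) :
    depth S t = 0 := by
  simp only [depth, List.countP_eq_zero, decide_eq_true_eq, not_and_or, not_le]
  exact h

end History

open History

/-- A set of reachable histories of an online coloring game in which the adversary may present
any closed interval, and the answer is a color distinct from those of all recorded intervals
meeting the new one. -/
structure IsColoringGame (Reach : History → Prop) : Prop where
  nil : Reach []
  step : ∀ S, Reach S → ∀ a b : ℝ, a ≤ b →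
    ∃ c, Reach ((a, b, c) :: S) ∧ ∀ e ∈ S, e.1 ≤ b → a ≤ e.2.1 → e.2.2 ≠ c

/-- Presenting `m` copies of the same interval. -/
lemma IsColoringGame.exists_copies {Reach : History → Prop} (hG : IsColoringGame Reach)
    {S : History} (hS : Reach S) {a b : ℝ} (hab : a ≤ b) (m : ℕ) :
    ∃ P : History, Reach (P ++ S) ∧ (∀ e ∈ P, e.1 = a ∧ e.2.1 = b) ∧ (colors P).card = m ∧
      (∀ t, depth P t = if a ≤ t ∧ t ≤ b then m else 0) ∧
      ∀ e ∈ S, e.1 ≤ b → a ≤ e.2.1 → e.2.2 ∉ colors P := by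
  induction m with
  | zero => exact ⟨[], by simpa using hS, by simp, by simp [colors], by simp [depth],
      by simp [colors]⟩
  | succ m ih =>
    obtain ⟨P, hR, hP, hcard, hd, hne⟩ := ih
    obtain ⟨c, hc, hcne⟩ := hG.step _ hR a b hab
    have hcP : c ∉ colors P := by
      rw [mem_colors]
      rintro ⟨e, he, rfl⟩
      obtain ⟨h1, h2⟩ := hP e he
      exact hcne e (by simp [he]) (by linarith) (by linarith) rfl
    refine ⟨(a, b, c) :: P, hc, ?_, ?_, ?_, ?_⟩
    · simpa using hP
    · have : colors ((a, b, c) :: P) = insert c (colors P) := by simp [colors]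
      rw [this, Finset.card_insert_of_notMem hcP, hcard]
    · intro t
      have : depth ((a, b, c) :: P) t = depth P t + if a ≤ t ∧ t ≤ b then 1 else 0 := by
        simp [depth, List.countP_cons]
      rw [this, hd]
      split_ifs <;> rfl
    · intro e he h1 h2
      have h3 := hne e he h1 h2
      have h4 := hcne e (by simp [he]) h1 h2
      simp only [colors, List.map_cons, List.toFinset_cons, Finset.mem_insert, not_or]
      exact ⟨h4, h3⟩

/-- The separation strategy for unit intervals: a clique in which the intervals with colors
outside `X` start before those with colors in `X`. It stops as soon as `k` intervals with colors
outside `X` have been presented. -/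
lemma IsColoringGame.exists_separated {Reach : History → Prop} (hG : IsColoringGame Reach)
    {S : History} (hS : Reach S) (X : Finset ℕ) (k : ℕ) {u v : ℝ} (huv : u < v)
    (hvu : v ≤ u + 1) (m : ℕ) :
    ∃ (P : History) (lo hi : ℝ), Reach (P ++ S) ∧ u ≤ lo ∧ lo < hi ∧ hi ≤ v ∧
      (∀ e ∈ P, e.2.1 = e.1 + 1 ∧ u ≤ e.1 ∧ e.1 ≤ v) ∧
      (∀ e ∈ P, e.2.2 ∉ X → e.1 ≤ lo) ∧ (∀ e ∈ P, e.2.2 ∈ X → hi ≤ e.1) ∧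
      P.length ≤ m ∧ (colors P).card = P.length ∧
      P.countP (fun e => decide (e.2.2 ∉ X)) = (colors P \ X).card ∧
      (colors P \ X).card ≤ k ∧ ((colors P \ X).card = k ∨ P.length = m) := by
  induction m with
  | zero =>
    exact ⟨[], u, v, by simpa using hS, le_rfl, huv, le_rfl, by simp, by simp, by simp, by simp,
      by simp [colors], by simp [colors], by simp [colors], by simp⟩
  | succ m ih =>
    obtain ⟨P, lo, hi, hR, h1, h2, h3, hP, hlo, hhi, hlen, hcard, hcount, hle, hor⟩ := ih
    by_cases hk : (colors P \ X).card = k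
    · exact ⟨P, lo, hi, hR, h1, h2, h3, hP, hlo, hhi, by omega, hcard, hcount, hle, Or.inl hk⟩
    have hlen : P.length = m := hor.resolve_left hk
    obtain ⟨c, hc, hcne⟩ := hG.step _ hR ((lo + hi) / 2) ((lo + hi) / 2 + 1) (by linarith)
    have hcP : c ∉ colors P := by
      rw [mem_colors]
      rintro ⟨e, he, rfl⟩
      obtain ⟨h4, h5, h6⟩ := hP e he
      exact hcne e (by simp [he]) (by linarith) (by linarith) rfl
    have hcol : colors (((lo + hi) / 2, (lo + hi) / 2 + 1, c) :: P) = insert c (colors P) := by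
      simp [colors]
    by_cases hcX : c ∈ X
    · refine ⟨((lo + hi) / 2, (lo + hi) / 2 + 1, c) :: P, lo, (lo + hi) / 2, hc, h1,
        by linarith, by linarith, ?_, ?_, ?_, by simp [hlen], ?_, ?_, ?_, by simp [hlen]⟩
      · simp only [List.mem_cons, forall_eq_or_imp]
        exact ⟨⟨trivial, by linarith, by linarith⟩, hP⟩
      · simp only [List.mem_cons, forall_eq_or_imp]
        exact ⟨fun h => absurd hcX h, hlo⟩
      · simp only [List.mem_cons, forall_eq_or_imp]
        exact ⟨fun _ => le_rfl, fun e he h => by linarith [hhi e he h]⟩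
      · rw [hcol, Finset.card_insert_of_notMem hcP, hcard, List.length_cons]
      · rw [hcol, Finset.insert_sdiff_of_mem _ hcX, ← hcount]
        simp [hcX]
      · rw [hcol, Finset.insert_sdiff_of_mem _ hcX]
        exact hle
    · refine ⟨((lo + hi) / 2, (lo + hi) / 2 + 1, c) :: P, (lo + hi) / 2, hi, hc, by linarith,
        by linarith, h3, ?_, ?_, ?_, by simp [hlen], ?_, ?_, ?_, by simp [hlen]⟩
      · simp only [List.mem_cons, forall_eq_or_imp]
        exact ⟨⟨trivial, by linarith, by linarith⟩, hP⟩
      · simp only [List.mem_cons, forall_eq_or_imp]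
        exact ⟨fun _ => le_rfl, fun e he h => by linarith [hlo e he h]⟩
      · simp only [List.mem_cons, forall_eq_or_imp]
        exact ⟨fun h => absurd h hcX, hhi⟩
      · rw [hcol, Finset.card_insert_of_notMem hcP, hcard, List.length_cons]
      · rw [hcol, Finset.insert_sdiff_of_notMem _ hcX, Finset.card_insert_of_notMem (by simp [hcP]),
          ← hcount]
        simp [hcX]
      · rw [hcol, Finset.insert_sdiff_of_notMem _ hcX, Finset.card_insert_of_notMem (by simp [hcP])]
        omega

/-- With unit intervals inside `[p, p + 4]` of depth at most `2 * k`, at least `3 * k` colors can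
be forced. -/
lemma IsColoringGame.exists_unit_gadget {Reach : History → Prop} (hG : IsColoringGame Reach)
    {S : History} (hS : Reach S) (k : ℕ) (p : ℝ) :
    ∃ P : History, Reach (P ++ S) ∧ (∀ e ∈ P, e.2.1 = e.1 + 1 ∧ p ≤ e.1 ∧ e.2.1 ≤ p + 4) ∧
      (∀ t, depth P t ≤ 2 * k) ∧ 3 * k ≤ (colors P).card := by
  obtain ⟨P, hRP, hP, hPcard, hPd, -⟩ :=
    hG.exists_copies hS (show p ≤ p + 1 by linarith) k
  obtain ⟨Q, lo, hi, hRQ, h1, h2, h3, hQ, hlo, hhi, hlen, hcard, hcount, hle, hor⟩ :=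
    hG.exists_separated hRP (colors P) k (show p + 5 / 4 < p + 2 by linarith) (by linarith) (2 * k)
  have hk : (colors Q \ colors P).card = k := by
    rcases hor with h | h
    · exact h
    · have := Finset.le_card_sdiff (colors P) (colors Q)
      omega
  obtain ⟨Z, hRZ, hZ, hZcard, hZd, hZne⟩ :=
    hG.exists_copies hRQ (show lo - 1 ≤ lo by linarith) k
  refine ⟨Z ++ (Q ++ P), by simpa using hRZ, ?_, ?_, ?_⟩
  · intro e he
    simp only [List.mem_append] at he
    rcases he with he | he | he
    · obtain ⟨h4, h5⟩ := hZ e he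
      exact ⟨by linarith, by linarith, by linarith⟩
    · obtain ⟨h4, h5, h6⟩ := hQ e he
      exact ⟨by linarith, by linarith, by linarith⟩
    · obtain ⟨h4, h5⟩ := hP e he
      exact ⟨by linarith, by linarith, by linarith⟩
  · intro t
    rw [depth_append, depth_append, hZd, hPd]
    have hQ2 : depth Q t ≤ 2 * k := (depth_le_length Q t).trans hlen
    by_cases ht : t ≤ p + 1
    · have : depth Q t = 0 := depth_eq_zero fun e he => Or.inl (by linarith [(hQ e he).2.1])
      split_ifs <;> omega
    · rw [if_neg (fun h : p ≤ t ∧ t ≤ p + 1 => ht h.2)]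
      by_cases ht2 : lo - 1 ≤ t ∧ t ≤ lo
      · have : depth Q t ≤ Q.countP (fun e => decide (e.2.2 ∉ colors P)) := by
          refine List.countP_mono_left fun e he h => ?_
          simp only [decide_eq_true_eq] at h ⊢
          intro hX
          linarith [hhi e he hX, h.1, ht2.2]
        rw [if_pos ht2]
        omega
      · rw [if_neg ht2]
        omega
  · have hZP : Disjoint (colors Z) (colors Q \ colors P ∪ colors P) := by
      rw [Finset.disjoint_right]
      intro c hc
      rw [Finset.mem_union, Finset.mem_sdiff, mem_colors] at hc
      rcases hc with ⟨⟨e, he, rfl⟩, hX⟩ | hc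
      · obtain ⟨h4, h5, h6⟩ := hQ e he
        exact hZne e (by simp [he]) (hlo e he hX) (by linarith)
      · obtain ⟨e, he, rfl⟩ := mem_colors.1 hc
        obtain ⟨h4, h5⟩ := hP e he
        exact hZne e (by simp [he]) (by linarith) (by linarith)
    rw [colors_append, colors_append, ← Finset.sdiff_union_self_eq_union (s := colors Q),
      Finset.card_union_of_disjoint hZP, Finset.card_union_of_disjoint Finset.sdiff_disjoint]
    omega

/-- The adversary wins with lengths `1` and `L`, depth `4 * k` and `8 * k` colors. -/
def AdversaryWins (Reach : History → Prop) (k : ℕ) : Prop :=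
  ∃ (S : History) (L : ℝ), Reach S ∧ (∀ e ∈ S, e.2.1 - e.1 = 1 ∨ e.2.1 - e.1 = L) ∧
    (∀ t, depth S t ≤ 4 * k) ∧ 8 * k ≤ (colors S).card

/-- The endgame with long intervals. If four clusters of unit intervals share `3 * k` colors, then
two bunches of long intervals through the outer clusters, possibly a third one shifted by little
from the first, and a last one crossing an inner cluster force `5 * k` further colors. -/
lemma IsColoringGame.adversaryWins_of_clusters {Reach : History → Prop}
    (hG : IsColoringGame Reach) {S : History} (hS : Reach S) {k : ℕ} {o D R : ℝ} (hD : 0 ≤ D)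
    (hR : 2 * D + 5 ≤ R) (hunit : ∀ e ∈ S, e.2.1 = e.1 + 1) (hdepth : ∀ t, depth S t ≤ 2 * k)
    (hloc : ∀ e ∈ S, e.2.1 < o ∨ (o ≤ e.1 ∧ e.2.1 ≤ o + D) ∨
      (o + R ≤ e.1 ∧ e.2.1 ≤ o + R + D) ∨ (o + R + D + 2 ≤ e.1 ∧ e.2.1 ≤ o + R + 2 * D + 2) ∨
      (o + 2 * R + D + 1 ≤ e.1 ∧ e.2.1 ≤ o + 2 * R + 2 * D + 1))
    {X : Finset ℕ} (hX : 3 * k ≤ X.card)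
    (h₁ : ∀ c ∈ X, ∃ e ∈ S, e.2.2 = c ∧ o ≤ e.1 ∧ e.2.1 ≤ o + D)
    (h₂ : ∀ c ∈ X, ∃ e ∈ S, e.2.2 = c ∧ o + R ≤ e.1 ∧ e.2.1 ≤ o + R + D)
    (h₃ : ∀ c ∈ X, ∃ e ∈ S, e.2.2 = c ∧ o + R + D + 2 ≤ e.1 ∧ e.2.1 ≤ o + R + 2 * D + 2)
    (h₄ : ∀ c ∈ X, ∃ e ∈ S, e.2.2 = c ∧ o + 2 * R + D + 1 ≤ e.1 ∧
      e.2.1 ≤ o + 2 * R + 2 * D + 1) :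
    AdversaryWins Reach k := by
  have hzero : ∀ t, ((o + D < t ∧ t < o + R) ∨ (o + R + D < t ∧ t < o + R + D + 2) ∨
      (o + R + 2 * D + 2 < t ∧ t < o + 2 * R + D + 1)) → depth S t = 0 := by
    intro t ht
    refine depth_eq_zero fun e he => ?_
    by_contra! hcon
    rcases ht with ht | ht | ht <;> rcases hloc e he with h | h | h | h | h <;> linarith
  have hXS : X ⊆ colors S := fun c hc => by
    obtain ⟨e, he, hec, -⟩ := h₁ c hc
    exact mem_colors.2 ⟨e, he, hec⟩
  obtain ⟨Y, hRY, hY, hYcard, hYd, hYne⟩ :=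
    hG.exists_copies hS (show o ≤ o + R - 1 by linarith) (2 * k)
  obtain ⟨V, hRV, hV, hVcard, hVd, hVne⟩ :=
    hG.exists_copies hRY
      (show o + R + 2 * D + 3 ≤ o + 2 * R + 2 * D + 2 by linarith) (2 * k)
  have hXY : Disjoint (colors Y) X := Finset.disjoint_right.2 fun c hc => by
    obtain ⟨e, he, rfl, h5, h6⟩ := h₁ c hc
    exact hYne e he (by linarith [hunit e he]) (by linarith [hunit e he])
  have hXV : Disjoint (colors V) X := Finset.disjoint_right.2 fun c hc => by
    obtain ⟨e, he, rfl, h5, h6⟩ := h₄ c hc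
    exact hVne e (by simp [he]) (by linarith [hunit e he]) (by linarith [hunit e he])
  by_cases hd : k ≤ (colors V \ colors Y).card
  · obtain ⟨Z, hRZ, hZ, hZcard, hZd, hZne⟩ :=
      hG.exists_copies hRV (show o + R - 1 ≤ o + 2 * R - 2 by linarith) (2 * k)
    have hZX : Disjoint (colors Z) X := Finset.disjoint_right.2 fun c hc => by
      obtain ⟨e, he, rfl, h5, h6⟩ := h₂ c hc
      exact hZne e (by simp [he]) (by linarith [hunit e he]) (by linarith [hunit e he])
    have hZV : Disjoint (colors Z) (colors V) := Finset.disjoint_right.2 fun c hc => by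
      obtain ⟨e, he, rfl⟩ := mem_colors.1 hc
      obtain ⟨h5, h6⟩ := hV e he
      exact hZne e (by simp [he]) (by linarith) (by linarith)
    have hZY : Disjoint (colors Z) (colors Y) := Finset.disjoint_right.2 fun c hc => by
      obtain ⟨e, he, rfl⟩ := mem_colors.1 hc
      obtain ⟨h5, h6⟩ := hY e he
      exact hZne e (by simp [he]) (by linarith) (by linarith)
    refine ⟨_, R - 1, hRZ, ?_, ?_, ?_⟩
    · intro e he
      simp only [List.mem_append] at he
      rcases he with he | he | he | he
      · right; linarith [(hZ e he).1, (hZ e he).2]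
      · right; linarith [(hV e he).1, (hV e he).2]
      · right; linarith [(hY e he).1, (hY e he).2]
      · left; linarith [hunit e he]
    · intro t
      rw [depth_append, depth_append, depth_append, hZd, hVd, hYd]
      have := hdepth t
      have h0 := hzero t
      split_ifs with h5 h6 h7 h7 h6 h7 h7
      · linarith
      · have := h0 (Or.inr (Or.inr ⟨by linarith, by linarith⟩))
        omega
      · have := h0 (Or.inl ⟨by linarith, by linarith⟩)
        omega
      · omega
      · linarith
      all_goals omega
    · have hsub : colors Z ∪ ((colors V \ colors Y ∪ colors Y) ∪ X) ⊆
          colors (Z ++ (V ++ (Y ++ S))) := by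
        simp only [colors_append]
        intro c
        have := @hXS c
        simp only [Finset.mem_union, Finset.mem_sdiff]
        tauto
      refine le_trans ?_ (Finset.card_le_card hsub)
      rw [Finset.sdiff_union_self_eq_union, Finset.card_union_of_disjoint,
        Finset.card_union_of_disjoint, ← Finset.sdiff_union_self_eq_union,
        Finset.card_union_of_disjoint Finset.sdiff_disjoint]
      · omega
      · exact Finset.disjoint_union_left.2 ⟨hXV, hXY⟩
      · exact Finset.disjoint_union_right.2 ⟨Finset.disjoint_union_right.2 ⟨hZV, hZY⟩, hZX⟩
  · obtain ⟨W, hRW, hW, hWcard, hWd, hWne⟩ :=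
      hG.exists_copies hRV (show o + D + 2 ≤ o + R + D + 1 by linarith) (2 * k)
    have hWX : Disjoint (colors W) X := Finset.disjoint_right.2 fun c hc => by
      obtain ⟨e, he, rfl, h5, h6⟩ := h₂ c hc
      exact hWne e (by simp [he]) (by linarith [hunit e he]) (by linarith [hunit e he])
    have hWY : Disjoint (colors W) (colors Y) := Finset.disjoint_right.2 fun c hc => by
      obtain ⟨e, he, rfl⟩ := mem_colors.1 hc
      obtain ⟨h5, h6⟩ := hY e he
      exact hWne e (by simp [he]) (by linarith) (by linarith)
    obtain ⟨Z, hRZ, hZ, hZcard, hZd, hZne⟩ :=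
      hG.exists_copies hRW (show o + R + D + 1 ≤ o + 2 * R + D by linarith) (2 * k)
    have hZX : Disjoint (colors Z) X := Finset.disjoint_right.2 fun c hc => by
      obtain ⟨e, he, rfl, h5, h6⟩ := h₃ c hc
      exact hZne e (by simp [he]) (by linarith [hunit e he]) (by linarith [hunit e he])
    have hZV : Disjoint (colors Z) (colors V) := Finset.disjoint_right.2 fun c hc => by
      obtain ⟨e, he, rfl⟩ := mem_colors.1 hc
      obtain ⟨h5, h6⟩ := hV e he
      exact hZne e (by simp [he]) (by linarith) (by linarith)
    have hZW : Disjoint (colors Z) (colors W) := Finset.disjoint_right.2 fun c hc => by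
      obtain ⟨e, he, rfl⟩ := mem_colors.1 hc
      obtain ⟨h5, h6⟩ := hW e he
      exact hZne e (by simp [he]) (by linarith) (by linarith)
    refine ⟨_, R - 1, hRZ, ?_, ?_, ?_⟩
    · intro e he
      simp only [List.mem_append] at he
      rcases he with he | he | he | he | he
      · right; linarith [(hZ e he).1, (hZ e he).2]
      · right; linarith [(hW e he).1, (hW e he).2]
      · right; linarith [(hV e he).1, (hV e he).2]
      · right; linarith [(hY e he).1, (hY e he).2]
      · left; linarith [hunit e he]
    · intro t
      rw [depth_append, depth_append, depth_append, depth_append, hZd, hWd, hVd, hYd]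
      have := hdepth t
      have h0 := hzero t
      by_cases hz : o + R + D + 1 ≤ t ∧ t ≤ o + 2 * R + D
      · rw [if_pos hz, if_neg (fun h : o ≤ t ∧ t ≤ o + R - 1 => by linarith)]
        by_cases hw : o + D + 2 ≤ t ∧ t ≤ o + R + D + 1
        · rw [if_pos hw, if_neg (fun h => by linarith),
            h0 (Or.inr (Or.inl ⟨by linarith, by linarith⟩))]
          omega
        · rw [if_neg hw]
          split_ifs with hv
          · rw [h0 (Or.inr (Or.inr ⟨by linarith, by linarith⟩))]
            omega
          · omega
      · rw [if_neg hz]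
        by_cases hv : o + R + 2 * D + 3 ≤ t ∧ t ≤ o + 2 * R + 2 * D + 2
        · rw [if_pos hv, if_neg (fun h => by linarith), if_neg (fun h => by linarith)]
          omega
        · rw [if_neg hv]
          split_ifs with hw hy
          · rw [h0 (Or.inl ⟨by linarith, by linarith⟩)]
            omega
          all_goals omega
    · have hsub : colors Z ∪ ((colors W ∪ colors V) ∪ X) ⊆
          colors (Z ++ (W ++ (V ++ (Y ++ S)))) := by
        simp only [colors_append]
        intro c
        have := @hXS c
        simp only [Finset.mem_union]
        tauto
      have hinter : (colors W ∩ colors V).card ≤ (colors V \ colors Y).card := by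
        refine Finset.card_le_card fun c hc => ?_
        rw [Finset.mem_inter] at hc
        exact Finset.mem_sdiff.2 ⟨hc.2, Finset.disjoint_left.1 hWY hc.1⟩
      have hunion := Finset.card_union_add_card_inter (colors W) (colors V)
      refine le_trans ?_ (Finset.card_le_card hsub)
      rw [Finset.card_union_of_disjoint, Finset.card_union_of_disjoint]
      · omega
      · exact Finset.disjoint_union_left.2 ⟨hWX, hXV⟩
      · exact Finset.disjoint_union_right.2 ⟨Finset.disjoint_union_right.2 ⟨hZW, hZV⟩, hZX⟩

/-- Unit intervals of depth at most `2 * k` to the left of `o`. -/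
structure IsUnitBefore (k : ℕ) (o : ℝ) (S : History) : Prop where
  unit : ∀ e ∈ S, e.2.1 = e.1 + 1
  lt : ∀ e ∈ S, e.2.1 < o
  depth_le : ∀ t, depth S t ≤ 2 * k

/-- Unit intervals of depth at most `2 * k` inside `[u, v]`. -/
structure IsUnitCluster (k : ℕ) (u v : ℝ) (P : History) : Prop where
  unit : ∀ e ∈ P, e.2.1 = e.1 + 1
  mem : ∀ e ∈ P, u ≤ e.1 ∧ e.2.1 ≤ v
  depth_le : ∀ t, depth P t ≤ 2 * k

lemma IsUnitBefore.append {k : ℕ} {o v w : ℝ} {S P : History} (hS : IsUnitBefore k o S)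
    (hP : IsUnitCluster k o v P) (hov : o ≤ w) (hvw : v < w) : IsUnitBefore k w (P ++ S) := by
  refine ⟨?_, ?_, ?_⟩
  · intro e he
    rcases List.mem_append.1 he with he | he
    exacts [hP.unit e he, hS.unit e he]
  · intro e he
    rcases List.mem_append.1 he with he | he
    · linarith [(hP.mem e he).2]
    · linarith [hS.lt e he]
  · intro t
    rw [depth_append]
    have h1 := hP.depth_le t
    have h2 := hS.depth_le t
    by_cases ht : t < o
    · rw [depth_eq_zero (S := P) fun e he => Or.inl (by linarith [(hP.mem e he).1])]
      omega
    · rw [depth_eq_zero (S := S) fun e he => Or.inr (by linarith [hS.lt e he])]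
      omega

/-- Unless the adversary wins, unit intervals of depth at most `2 * k` in a bounded region force
any number of colors: clusters that do not win together cannot all have the same colors. -/
lemma IsColoringGame.exists_cluster {Reach : History → Prop} (hG : IsColoringGame Reach) (k n : ℕ) :
    ∃ D : ℝ, 0 ≤ D ∧ ∀ (S : History) (o : ℝ), Reach S → IsUnitBefore k o S →
      AdversaryWins Reach k ∨
        ∃ P, Reach (P ++ S) ∧ IsUnitCluster k o (o + D) P ∧ 3 * k + n ≤ (colors P).card := by
  induction n with
  | zero =>
    refine ⟨4, by norm_num, fun S o hS _ => Or.inr ?_⟩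
    obtain ⟨P, hR, hP, hd, hc⟩ := hG.exists_unit_gadget hS k o
    exact ⟨P, hR, ⟨fun e he => (hP e he).1, fun e he => (hP e he).2, hd⟩, hc⟩
  | succ n ih =>
    obtain ⟨D, hD, ih⟩ := ih
    obtain ⟨R, hR⟩ : ∃ R, R = 2 * D + 5 := ⟨_, rfl⟩
    refine ⟨2 * R + 2 * D + 1, by linarith, fun S o hS hb => ?_⟩
    by_cases hwin : AdversaryWins Reach k
    · exact Or.inl hwin
    obtain ⟨P₁, hR₁, hP₁, hc₁⟩ := (ih S o hS hb).resolve_left hwin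
    have hb₁ : IsUnitBefore k (o + R) (P₁ ++ S) := hb.append hP₁ (by linarith) (by linarith)
    obtain ⟨P₂, hR₂, hP₂, hc₂⟩ := (ih _ _ hR₁ hb₁).resolve_left hwin
    have hb₂ : IsUnitBefore k (o + R + D + 2) (P₂ ++ (P₁ ++ S)) :=
      hb₁.append hP₂ (by linarith) (by linarith)
    obtain ⟨P₃, hR₃, hP₃, hc₃⟩ := (ih _ _ hR₂ hb₂).resolve_left hwin
    have hb₃ : IsUnitBefore k (o + 2 * R + D + 1) (P₃ ++ (P₂ ++ (P₁ ++ S))) :=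
      hb₂.append hP₃ (by linarith) (by linarith)
    obtain ⟨P₄, hR₄, hP₄, hc₄⟩ := (ih _ _ hR₃ hb₃).resolve_left hwin
    have hb₄ : IsUnitBefore k (o + 2 * R + 2 * D + 2) (P₄ ++ (P₃ ++ (P₂ ++ (P₁ ++ S)))) :=
      hb₃.append hP₄ (by linarith) (by linarith)
    have hnew : ∀ e ∈ P₄ ++ (P₃ ++ (P₂ ++ P₁)), (o ≤ e.1 ∧ e.2.1 ≤ o + D) ∨
        (o + R ≤ e.1 ∧ e.2.1 ≤ o + R + D) ∨
        (o + R + D + 2 ≤ e.1 ∧ e.2.1 ≤ o + R + 2 * D + 2) ∨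
        (o + 2 * R + D + 1 ≤ e.1 ∧ e.2.1 ≤ o + 2 * R + 2 * D + 1) := by
      intro e he
      simp only [List.mem_append] at he
      rcases he with he | he | he | he
      · exact Or.inr (Or.inr (Or.inr ⟨(hP₄.mem e he).1, by linarith [(hP₄.mem e he).2]⟩))
      · exact Or.inr (Or.inr (Or.inl ⟨(hP₃.mem e he).1, by linarith [(hP₃.mem e he).2]⟩))
      · exact Or.inr (Or.inl (hP₂.mem e he))
      · exact Or.inl (hP₁.mem e he)
    by_cases hcard : 3 * k ≤ (colors P₁ ∩ colors P₂ ∩ colors P₃ ∩ colors P₄).card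
    · refine absurd (hG.adversaryWins_of_clusters (o := o) hR₄ hD hR.ge hb₄.unit hb₄.depth_le ?_ hcard
        ?_ ?_ ?_ ?_) hwin
      · intro e he
        by_cases heS : e ∈ S
        · exact Or.inl (hb.lt e heS)
        · refine Or.inr (hnew e ?_)
          simpa [heS] using he
      all_goals
        intro c hc
        simp only [Finset.mem_inter, mem_colors] at hc
        obtain ⟨⟨⟨⟨e₁, he₁, hce₁⟩, ⟨e₂, he₂, hce₂⟩⟩, ⟨e₃, he₃, hce₃⟩⟩, ⟨e₄, he₄, hce₄⟩⟩ := hc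
      · exact ⟨e₁, by simp [he₁], hce₁, hP₁.mem e₁ he₁⟩
      · exact ⟨e₂, by simp [he₂], hce₂, hP₂.mem e₂ he₂⟩
      · exact ⟨e₃, by simp [he₃], hce₃, (hP₃.mem e₃ he₃).1, by linarith [(hP₃.mem e₃ he₃).2]⟩
      · exact ⟨e₄, by simp [he₄], hce₄, (hP₄.mem e₄ he₄).1, by linarith [(hP₄.mem e₄ he₄).2]⟩
    · refine Or.inr ⟨P₄ ++ (P₃ ++ (P₂ ++ P₁)), by simpa using hR₄, ⟨?_, ?_, ?_⟩, ?_⟩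
      · intro e he
        refine hb₄.unit e ?_
        simp only [List.mem_append] at he ⊢
        tauto
      · intro e he
        rcases hnew e he with h | h | h | h <;> constructor <;> linarith
      · intro t
        refine le_trans ?_ (hb₄.depth_le t)
        simp only [depth_append]
        omega
      · by_contra! hlt
        have hU : ∀ Q : History, colors Q ⊆ colors (P₄ ++ (P₃ ++ (P₂ ++ P₁))) →
            3 * k + n ≤ (colors Q).card → colors Q = colors (P₄ ++ (P₃ ++ (P₂ ++ P₁))) :=
          fun Q hQ hQc => Finset.eq_of_subset_of_card_le hQ (by omega)
        have e₁ := hU P₁ (by intro c; simp only [colors_append, Finset.mem_union]; tauto) hc₁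
        have e₂ := hU P₂ (by intro c; simp only [colors_append, Finset.mem_union]; tauto) hc₂
        have e₃ := hU P₃ (by intro c; simp only [colors_append, Finset.mem_union]; tauto) hc₃
        have e₄ := hU P₄ (by intro c; simp only [colors_append, Finset.mem_union]; tauto) hc₄
        refine hcard ?_
        rw [e₂, e₃, e₄, ← e₁]
        simp only [Finset.inter_self]
        omega

/-- In every coloring game the adversary wins. -/
theorem IsColoringGame.adversaryWins {Reach : History → Prop} (hG : IsColoringGame Reach)
    (k : ℕ) : AdversaryWins Reach k := by
  obtain ⟨D, -, h⟩ := hG.exists_cluster k (5 * k)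
  rcases h [] 0 hG.nil ⟨by simp, by simp, by simp [depth]⟩ with h | ⟨P, hR, hP, hc⟩
  · exact h
  · refine ⟨P ++ [], 1, hR, ?_, ?_, ?_⟩
    · intro e he
      rw [List.append_nil] at he
      exact Or.inl (by linarith [hP.unit e he])
    · intro t
      rw [List.append_nil]
      have := hP.depth_le t
      omega
    · rw [List.append_nil]
      omega

/-- The history recorded when a sequence of intervals is presented to `A`. -/
def knownHistory (A : KnownRepAlg) {n : ℕ} (x : Fin n → ℝ × ℝ) : History :=
  (List.ofFn fun i => ((x i).1, (x i).2, knownColoring A x i)).reverse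

lemma knownColoring_snoc_castSucc (A : KnownRepAlg) {n : ℕ} (x : Fin n → ℝ × ℝ) (y : ℝ × ℝ)
    (i : Fin n) :
    knownColoring A (Fin.snoc x y : Fin (n + 1) → ℝ × ℝ) i.castSucc = knownColoring A x i := by
  unfold knownColoring
  congr 1
  funext j
  exact Fin.snoc_castSucc (α := fun _ => ℝ × ℝ) y x (Fin.castLE i.isLt j)

lemma knownHistory_snoc (A : KnownRepAlg) {n : ℕ} (x : Fin n → ℝ × ℝ) (y : ℝ × ℝ) :
    knownHistory A (Fin.snoc x y : Fin (n + 1) → ℝ × ℝ) =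
      (y.1, y.2, knownColoring A (Fin.snoc x y : Fin (n + 1) → ℝ × ℝ) (Fin.last n)) ::
        knownHistory A x := by
  simp [knownHistory, List.ofFn_succ', knownColoring_snoc_castSucc, -List.ofFn_succ]

lemma mem_knownHistory {A : KnownRepAlg} {n : ℕ} {x : Fin n → ℝ × ℝ} {e : ℝ × ℝ × ℕ} :
    e ∈ knownHistory A x ↔ ∃ i, ((x i).1, (x i).2, knownColoring A x i) = e := by
  simp [knownHistory, List.mem_ofFn]

lemma depth_knownHistory (A : KnownRepAlg) {n : ℕ} (x : Fin n → ℝ × ℝ) (t : ℝ) :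
    depth (knownHistory A x) t = {i : Fin n | t ∈ Set.Icc (x i).1 (x i).2}.ncard := by
  classical
  have h : {i : Fin n | t ∈ Set.Icc (x i).1 (x i).2} =
      (((List.finRange n).filter fun i => decide ((x i).1 ≤ t ∧ t ≤ (x i).2)).toFinset :
        Set (Fin n)) := by
    ext i
    simp
  rw [h, Set.ncard_coe_finset, List.toFinset_card_of_nodup ((List.nodup_finRange n).filter _),
    depth, knownHistory, List.countP_reverse, List.ofFn_eq_map, List.countP_map,
    List.countP_eq_length_filter]
  rfl

lemma isColoringGame_of_isProperKnown {A : KnownRepAlg} (hA : IsProperKnown A) :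
    IsColoringGame fun S => ∃ (n : ℕ) (x : Fin n → ℝ × ℝ),
      (∀ i, (x i).1 ≤ (x i).2) ∧ S = knownHistory A x where
  nil := ⟨0, Fin.elim0, fun i => i.elim0, by simp [knownHistory]⟩
  step := by
    rintro S ⟨n, x, hx, rfl⟩ a b hab
    have hx' : ∀ i, ((Fin.snoc x (a, b) : Fin (n + 1) → ℝ × ℝ) i).1 ≤
        ((Fin.snoc x (a, b) : Fin (n + 1) → ℝ × ℝ) i).2 := by
      intro i
      induction i using Fin.lastCases with
      | last => simpa using hab
      | cast i => simpa using hx i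
    refine ⟨_, ⟨n + 1, Fin.snoc x (a, b), hx', (knownHistory_snoc A x (a, b)).symm⟩, ?_⟩
    intro e he h1 h2
    obtain ⟨i, rfl⟩ := mem_knownHistory.1 he
    have := hA (n + 1) (Fin.snoc x (a, b)) hx' i.castSucc (Fin.last n) (Fin.castSucc_ne_last i) (by
      simp only [Fin.snoc_castSucc, Fin.snoc_last]
      exact ⟨max (x i).1 a, ⟨le_max_left _ _, max_le (hx i) h2⟩, ⟨le_max_right _ _, max_le h1 hab⟩⟩)
    rwa [knownColoring_snoc_castSucc] at this

theorem stmt13 (k : ℕ) (hk : 1 ≤ k) (A : KnownRepAlg) (hA : IsProperKnown A) :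
    ∃ (n : ℕ) (x : Fin n → ℝ × ℝ),
      (∀ i, (x i).1 ≤ (x i).2) ∧
      (∃ L₁ L₂ : ℝ, ∀ i, (x i).2 - (x i).1 = L₁ ∨ (x i).2 - (x i).1 = L₂) ∧
      (∀ t : ℝ, {i : Fin n | t ∈ Set.Icc (x i).1 (x i).2}.ncard ≤ 4 * k) ∧
      8 * k ≤ (Set.range (knownColoring A x)).ncard := by
  obtain ⟨S, L, ⟨n, x, hx, rfl⟩, hlen, hdepth, hcol⟩ :=
    (isColoringGame_of_isProperKnown hA).adversaryWins k
  refine ⟨n, x, hx, ⟨1, L, fun i => hlen _ (mem_knownHistory.2 ⟨i, rfl⟩)⟩, fun t => ?_, ?_⟩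
  · rw [← depth_knownHistory A]
    exact hdepth t
  · have : Set.range (knownColoring A x) = colors (knownHistory A x) := by
      ext c
      simp [mem_colors, mem_knownHistory]
    rw [this, Set.ncard_coe_finset]
    exact hcol
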